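/- arXiv:0707.0248 — 4 statements merged into one kernel-verified Lean document; each statement's English description precedes it below -/
import Mathlib

section
/- Let c_A ≠ c_B be two points of E = EuclideanSpace ℝ (Fin 3), v > 0, and f_X(t, r) = t − ‖r − c_X‖/v for X ∈ {A, B}. At every point (t, r) with r ≠ c_A and r ≠ c_B, the two derivative covectors fderiv f_A (t,r) and fderiv f_B (t,r) are linearly dependent (equivalently, d f_A ∧ d f_B = 0, so the emission coordinate system degenerates there) if and only if the unit vectors coincide: (r − c_A)/‖r − c_A‖ = (r − c_B)/‖r − c_B‖. -/
/-- The Newtonian emission coordinate of an emitter at rest at `c` broadcasting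
signals of speed `v`: `f(t, r) = t − ‖r − c‖/v`. -/
noncomputable def emissionCoord (c : EuclideanSpace ℝ (Fin 3)) (v : ℝ) :
    ℝ × EuclideanSpace ℝ (Fin 3) → ℝ :=
  fun p => p.1 - ‖p.2 - c‖ / v

theorem emissionCoord_fderiv_apply (c : EuclideanSpace ℝ (Fin 3)) (v t : ℝ)
    (r : EuclideanSpace ℝ (Fin 3)) (hr : r ≠ c) (s : ℝ) (w : EuclideanSpace ℝ (Fin 3)) :
    fderiv ℝ (emissionCoord c v) (t, r) (s, w) =
      s - inner ℝ (‖r - c‖⁻¹ • (r - c)) w / v := by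
  have hne : r - c ≠ 0 := sub_ne_zero.mpr hr
  have hn : ‖r - c‖ ≠ 0 := norm_ne_zero_iff.mpr hne
  have h1 : HasFDerivAt (fun p : ℝ × EuclideanSpace ℝ (Fin 3) => p.2 - c)
      (ContinuousLinearMap.snd ℝ ℝ (EuclideanSpace ℝ (Fin 3))) (t, r) :=
    hasFDerivAt_snd.sub_const c
  have h2 := (h1.norm_sq).sqrt (pow_ne_zero 2 hn)
  have h3 := (hasFDerivAt_fst (𝕜 := ℝ) (p := (t, r))).sub (h2.mul_const v⁻¹)
  have h4 : emissionCoord c v = fun p : ℝ × EuclideanSpace ℝ (Fin 3) =>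
      p.1 - √(‖p.2 - c‖ ^ 2) * v⁻¹ := by
    funext p
    simp [emissionCoord, Real.sqrt_sq (norm_nonneg _), div_eq_mul_inv]
  rw [h4]
  erw [h3.fderiv]
  simp [Real.sqrt_sq (norm_nonneg _), real_inner_smul_left]
  field_simp
  rw [inner_sub_left]

/-- For two emitters at rest at `c_A ≠ c_B` and an event `(t, r)` with `r ≠ c_A`,
`r ≠ c_B`, the derivative covectors `d f_A` and `d f_B` of the two emission
coordinates are linearly dependent (`d f_A ∧ d f_B = 0`, degeneracy of the emission
coordinate system) iff the unit vectors from the emitters coincide: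
`(r − c_A)/‖r − c_A‖ = (r − c_B)/‖r − c_B‖`. -/
theorem emission_coords_degenerate_iff_same_direction
    (cA cB : EuclideanSpace ℝ (Fin 3)) (hAB : cA ≠ cB) (v : ℝ) (hv : 0 < v)
    (t : ℝ) (r : EuclideanSpace ℝ (Fin 3)) (hrA : r ≠ cA) (hrB : r ≠ cB) :
    ¬ LinearIndependent ℝ
        ![fderiv ℝ (emissionCoord cA v) (t, r),
          fderiv ℝ (emissionCoord cB v) (t, r)] ↔
      ‖r - cA‖⁻¹ • (r - cA) = ‖r - cB‖⁻¹ • (r - cB) := by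
  have hA := emissionCoord_fderiv_apply cA v t r hrA
  have hB := emissionCoord_fderiv_apply cB v t r hrB
  generalize fderiv ℝ (emissionCoord cA v) (t, r) = F at *
  generalize fderiv ℝ (emissionCoord cB v) (t, r) = G at *
  have hF0 : F ≠ 0 := by
    rintro rfl
    have := hA 1 0
    simp at this
  rw [LinearIndependent.pair_iff' hF0]
  push Not
  constructor
  · rintro ⟨a, ha⟩
    have ha1 : a = 1 := by
      have h := hB 1 0
      rw [← ha, smul_apply, hA] at h
      simpa using h
    subst ha1
    rw [one_smul] at ha
    subst ha
    refine ext_inner_right ℝ fun w => ?_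
    have h := (hA 0 w).symm.trans (hB 0 w)
    exact (div_left_inj' hv.ne').mp (sub_right_injective h)
  · intro h
    refine ⟨1, ?_⟩
    rw [one_smul]
    ext1 <;> ext1
    · simp [hA, hB]
    · simp only [ContinuousLinearMap.comp_apply, ContinuousLinearMap.inr_apply, hA, hB, h]
end

section
/- Let E be a real inner product space and u, v, w ∈ E with ‖u‖ = ‖v‖ = ‖w‖ = 1 and ⟪u, v⟫ < 1 (in particular u ≠ v). If w = α • u + β • v with α ≠ 0 and β ≠ 0, then α + β ≠ 1. (Consequently, in Newtonian emission coordinates, the coordinate 3-coplane d t^A ∧ d t^B ∧ d t^C, which equals (1 − α − β) dt ∧ ω^A ∧ ω^B when ω^C = α ω^A + β ω^B, cannot degenerate off the shadow strips.) -/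
open scoped RealInnerProductSpace

/-- If `u`, `v`, `w` are unit vectors of a real inner product space with
`⟪u, v⟫ < 1` and `w = α • u + β • v` with `α ≠ 0` and `β ≠ 0`, then `α + β ≠ 1`.
(Hence the Newtonian emission coordinate 3-coplane
`d t^A ∧ d t^B ∧ d t^C = (1 − α − β) dt ∧ ω^A ∧ ω^B` cannot degenerate off the
shadow strips.) -/
theorem unit_combination_coeffs_ne_one
    {E : Type*} [NormedAddCommGroup E] [InnerProductSpace ℝ E]
    (u v w : E) (hu : ‖u‖ = 1) (hv : ‖v‖ = 1) (hw : ‖w‖ = 1)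
    (huv : ⟪u, v⟫ < 1) (α β : ℝ) (hα : α ≠ 0) (hβ : β ≠ 0)
    (hw' : w = α • u + β • v) : α + β ≠ 1 := by
  intro hsum
  have h1 : ‖w‖ ^ 2 = α ^ 2 + 2 * (α * β * ⟪u, v⟫) + β ^ 2 := by
    rw [hw', norm_add_sq_real, norm_smul, norm_smul, hu, hv, real_inner_smul_left,
      real_inner_smul_right, mul_one, mul_one, Real.norm_eq_abs, Real.norm_eq_abs,
      sq_abs, sq_abs, mul_assoc α β]
  rw [hw] at h1
  have h2 : (α * β) * (1 - ⟪u, v⟫) = 0 := by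
    have h3 : (α + β) ^ 2 = 1 := by rw [hsum]; norm_num
    linarith [h3, h1, add_sq α β]
  rcases mul_eq_zero.mp h2 with h | h
  · exact mul_ne_zero hα hβ h
  · linarith
end

section
/- Let c : Fin 4 → E with E = EuclideanSpace ℝ (Fin 3), v > 0, and define the Newtonian emission map F : ℝ × E → ℝ⁴ by F(t, r)_A = t − ‖r − c_A‖/v. At a point (t, r) with r ≠ c_A for all A, set u_A = (r − c_A)/‖r − c_A‖. Then the derivative fderiv F (t, r) is a linear isomorphism of ℝ × E onto ℝ⁴ if and only if the three vectors u_0 − u_3, u_1 − u_3, u_2 − u_3 are linearly independent in E. -/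
/-- The Newtonian emission map of four emitters at rest at positions `c_A`
broadcasting signals of speed `v`: `F(t, r)_A = t − ‖r − c_A‖/v`. -/
noncomputable def emissionMap (c : Fin 4 → EuclideanSpace ℝ (Fin 3)) (v : ℝ) :
    ℝ × EuclideanSpace ℝ (Fin 3) → (Fin 4 → ℝ) :=
  fun p A => p.1 - ‖p.2 - c A‖ / v

theorem emission_hasFDerivAt_comp (c : EuclideanSpace ℝ (Fin 3))
    (v : ℝ) (t : ℝ) (r : EuclideanSpace ℝ (Fin 3)) (hr : r ≠ c) :
    HasFDerivAt (fun p : ℝ × EuclideanSpace ℝ (Fin 3) => p.1 - ‖p.2 - c‖ / v)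
      (ContinuousLinearMap.fst ℝ ℝ (EuclideanSpace ℝ (Fin 3)) -
        v⁻¹ • ((innerSL ℝ (‖r - c‖⁻¹ • (r - c))).comp
          (ContinuousLinearMap.snd ℝ ℝ (EuclideanSpace ℝ (Fin 3))))) (t, r) := by
  have hne : ‖r - c‖ ≠ 0 := norm_ne_zero_iff.mpr (sub_ne_zero.mpr hr)
  have h1 : HasFDerivAt (fun p : ℝ × EuclideanSpace ℝ (Fin 3) => p.2 - c)
      (ContinuousLinearMap.snd ℝ ℝ (EuclideanSpace ℝ (Fin 3))) (t, r) :=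
    hasFDerivAt_snd.sub_const c
  have h2 := (h1.norm_sq.sqrt (by simpa using hne)).const_mul v⁻¹
  have h3 := (hasFDerivAt_fst (𝕜 := ℝ) (p := (t, r))).sub h2
  refine (h3.congr_fderiv ?_).congr_of_eventuallyEq (Filter.Eventually.of_forall ?_)
  · ext x
    · simp
    · simp
      field_simp
      simp
  · intro p
    simp [Real.sqrt_sq (norm_nonneg _), div_eq_inv_mul]

theorem emission_fderiv_apply (c : Fin 4 → EuclideanSpace ℝ (Fin 3))
    (v : ℝ) (t : ℝ) (r : EuclideanSpace ℝ (Fin 3))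
    (hr : ∀ A : Fin 4, r ≠ c A) (p : ℝ × EuclideanSpace ℝ (Fin 3)) (A : Fin 4) :
    fderiv ℝ (emissionMap c v) (t, r) p A =
      p.1 - v⁻¹ * inner ℝ (‖r - c A‖⁻¹ • (r - c A)) p.2 := by
  have h := hasFDerivAt_pi.mpr fun A => emission_hasFDerivAt_comp (c A) v t r (hr A)
  have h' : fderiv ℝ (emissionMap c v) (t, r) = _ := h.fderiv
  rw [h']
  rfl

theorem linInd_iff_orth (d : Fin 3 → EuclideanSpace ℝ (Fin 3)) :
    LinearIndependent ℝ d ↔ ∀ w, (∀ i, inner ℝ (d i) w = 0) → w = 0 := by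
  have hspan : (Fintype.card (Fin 3) = (Set.range d).finrank ℝ) ↔
      Submodule.span ℝ (Set.range d) = ⊤ := by
    constructor
    · intro h
      apply Submodule.eq_top_of_finrank_eq
      rw [finrank_euclideanSpace]
      exact h.symm
    · intro h
      rw [Set.finrank, h, finrank_top, finrank_euclideanSpace]
  rw [linearIndependent_iff_card_eq_finrank_span, hspan,
    ← Submodule.orthogonal_eq_bot_iff, Submodule.eq_bot_iff]
  refine forall_congr' fun w => imp_congr_left ?_
  rw [Submodule.mem_orthogonal]
  constructor
  · exact fun h i => h _ (Submodule.subset_span ⟨i, rfl⟩)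
  · intro h u hu
    induction hu using Submodule.span_induction with
    | mem x hx => obtain ⟨i, rfl⟩ := hx; exact h i
    | zero => simp
    | add x y _ _ hx hy => rw [inner_add_left, hx, hy, add_zero]
    | smul a x _ hx => rw [inner_smul_left, hx, mul_zero]

/-- At an event `(t, r)` off the four emitter worldlines, with unit vectors
`u_A = (r − c_A)/‖r − c_A‖`, the derivative of the Newtonian emission map is a
linear isomorphism of `ℝ × E` onto ℝ⁴ iff the three vectors `u_0 − u_3`,
`u_1 − u_3`, `u_2 − u_3` are linearly independent. -/
theorem emission_jacobian_iso_iff (c : Fin 4 → EuclideanSpace ℝ (Fin 3))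
    (v : ℝ) (hv : 0 < v) (t : ℝ) (r : EuclideanSpace ℝ (Fin 3))
    (hr : ∀ A : Fin 4, r ≠ c A) :
    Function.Bijective (fderiv ℝ (emissionMap c v) (t, r)) ↔
      LinearIndependent ℝ
        ![‖r - c 0‖⁻¹ • (r - c 0) - ‖r - c 3‖⁻¹ • (r - c 3),
          ‖r - c 1‖⁻¹ • (r - c 1) - ‖r - c 3‖⁻¹ • (r - c 3),
          ‖r - c 2‖⁻¹ • (r - c 2) - ‖r - c 3‖⁻¹ • (r - c 3)] := by
  have hap := emission_fderiv_apply c v t r hr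
  rw [linInd_iff_orth]
  generalize hL : fderiv ℝ (emissionMap c v) (t, r) = L at *
  have hbij : Function.Bijective L ↔ Function.Injective L := by
    refine ⟨fun h => h.1, fun h => ⟨h, ?_⟩⟩
    exact (LinearMap.injective_iff_surjective_of_finrank_eq_finrank
      (f := (L : ℝ × EuclideanSpace ℝ (Fin 3) →ₗ[ℝ] (Fin 4 → ℝ))) (by simp)).mp h
  rw [hbij, injective_iff_map_eq_zero]
  generalize hu : (fun A => ‖r - c A‖⁻¹ • (r - c A)) = u at *
  have hu' : ∀ A, ‖r - c A‖⁻¹ • (r - c A) = u A := fun A => congrFun hu A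
  simp only [hu'] at hap ⊢
  have hv' : v⁻¹ ≠ 0 := inv_ne_zero hv.ne'
  constructor
  · intro h w hw
    have h0 := hw 0
    have h1 := hw 1
    have h2 := hw 2
    simp [inner_sub_left] at h0 h1 h2
    have hA : ∀ A, inner ℝ (u A) w = inner ℝ (u 3) w := by
      intro A
      fin_cases A
      · exact sub_eq_zero.mp h0
      · exact sub_eq_zero.mp h1
      · exact sub_eq_zero.mp h2
      · rfl
    have := h (v⁻¹ * inner ℝ (u 3) w, w) (by
      ext A
      rw [hap]
      simp only [hA A, sub_self, Pi.zero_apply])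
    exact (Prod.ext_iff.mp this).2
  · rintro h ⟨s, w⟩ hp
    have key : ∀ A, s = v⁻¹ * inner ℝ (u A) w := by
      intro A
      have := hap (s, w) A
      rw [hp] at this
      simp at this
      linarith
    have e : ∀ A, inner ℝ (u A) w = inner ℝ (u 3) w := fun A =>
      mul_left_cancel₀ hv' ((key A).symm.trans (key 3))
    have hw : w = 0 := h w (by
      intro i
      fin_cases i <;> simp [inner_sub_left, e 0, e 1, e 2])
    have hs := key 3
    subst hw
    simpa using hs
end

section
/- In Minkowski space-time ℝ⁴ with η(x, y) = −x₀y₀ + x₁y₁ + x₂y₂ + x₃y₃, let 0 < v ≤ 1 and let u_A, u_B ∈ ℝ³ be Euclidean unit vectors; set p_X = (1, −u_X/v) ∈ ℝ⁴ (the component vector of the emission gradient covector d t^X) and μ = ⟪u_A, u_B⟫. Then: (i) η(p_A, p_A) = −1 + 1/v², so p_A is spacelike for every v < 1 and null for v = 1 (hence emission coordinate systems with light signals have coframe of causal type {l l l l}); (ii) the Gram determinant satisfies η(p_A, p_A) η(p_B, p_B) − η(p_A, p_B)² = (1/v⁴)(1 − μ)(1 + μ − 2v²), so for μ < 1 the coordinate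 2-coplane {t^A = const, t^B = const} is spacelike, null or timelike according as μ is greater than, equal to, or smaller than 2v² − 1. -/
open scoped RealInnerProductSpace

/-- The Minkowski form on ℝ⁴: `η(x, y) = −x₀y₀ + x₁y₁ + x₂y₂ + x₃y₃`. -/
def mink (x y : Fin 4 → ℝ) : ℝ :=
  -(x 0 * y 0) + x 1 * y 1 + x 2 * y 2 + x 3 * y 3

/-- The component vector `p = (1, −u/v)` of the emission gradient covector `dt^X`
for signal speed `v` and Euclidean unit direction `u` from the emitter. -/
noncomputable def emGrad (v : ℝ) (u : EuclideanSpace ℝ (Fin 3)) : Fin 4 → ℝ :=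
  ![1, -(u 0) / v, -(u 1) / v, -(u 2) / v]

/-- For relativistic emission coordinates with signal speed `0 < v ≤ 1` and unit
direction vectors `u_A`, `u_B` with `μ = ⟪u_A, u_B⟫`:
(i) `η(p_A, p_A) = −1 + 1/v²`, so `p_A` is spacelike for `v < 1` and null for
`v = 1` (light signals give a coframe of causal type `{l l l l}`);
(ii) the Gram determinant is
`η(p_A,p_A) η(p_B,p_B) − η(p_A,p_B)² = (1/v⁴)(1 − μ)(1 + μ − 2v²)`, so for `μ < 1`
the coordinate 2-coplane `{t^A = const, t^B = const}` is spacelike, null or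
timelike according as `μ` is greater than, equal to, or smaller than `2v² − 1`
(positive, zero or negative Gram determinant). -/
theorem relativistic_emission_coframe_and_coplanes
    (v : ℝ) (hv0 : 0 < v) (hv1 : v ≤ 1)
    (uA uB : EuclideanSpace ℝ (Fin 3)) (hA : ‖uA‖ = 1) (hB : ‖uB‖ = 1) :
    mink (emGrad v uA) (emGrad v uA) = -1 + 1 / v ^ 2 ∧
    (v < 1 → 0 < mink (emGrad v uA) (emGrad v uA)) ∧
    (v = 1 → mink (emGrad v uA) (emGrad v uA) = 0) ∧
    mink (emGrad v uA) (emGrad v uA) * mink (emGrad v uB) (emGrad v uB)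
        - (mink (emGrad v uA) (emGrad v uB)) ^ 2
      = (1 / v ^ 4) * (1 - ⟪uA, uB⟫) * (1 + ⟪uA, uB⟫ - 2 * v ^ 2) ∧
    (⟪uA, uB⟫ < 1 →
      ((0 < mink (emGrad v uA) (emGrad v uA) * mink (emGrad v uB) (emGrad v uB)
          - (mink (emGrad v uA) (emGrad v uB)) ^ 2 ↔ 2 * v ^ 2 - 1 < ⟪uA, uB⟫) ∧
       (mink (emGrad v uA) (emGrad v uA) * mink (emGrad v uB) (emGrad v uB)
          - (mink (emGrad v uA) (emGrad v uB)) ^ 2 = 0 ↔ ⟪uA, uB⟫ = 2 * v ^ 2 - 1) ∧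
       (mink (emGrad v uA) (emGrad v uA) * mink (emGrad v uB) (emGrad v uB)
          - (mink (emGrad v uA) (emGrad v uB)) ^ 2 < 0 ↔ ⟪uA, uB⟫ < 2 * v ^ 2 - 1))) := by
  have hv : v ≠ 0 := hv0.ne'
  have key : ∀ x y : EuclideanSpace ℝ (Fin 3),
      mink (emGrad v x) (emGrad v y) = -1 + ⟪x, y⟫ / v ^ 2 := by
    intro x y
    simp [mink, emGrad, PiLp.inner_apply, Fin.sum_univ_three]
    field_simp
    ring
  have hAA : ⟪uA, uA⟫ = 1 := by rw [real_inner_self_eq_norm_sq, hA]; norm_num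
  have hBB : ⟪uB, uB⟫ = 1 := by rw [real_inner_self_eq_norm_sq, hB]; norm_num
  rw [key uA uA, key uB uB, key uA uB, hAA, hBB]
  generalize ⟪uA, uB⟫ = μ
  have hG : (-1 + 1 / v ^ 2) * (-1 + 1 / v ^ 2) - (-1 + μ / v ^ 2) ^ 2
      = (1 / v ^ 4) * (1 - μ) * (1 + μ - 2 * v ^ 2) := by
    field_simp
    ring
  refine ⟨rfl, ?_, ?_, hG, ?_⟩
  · intro h
    have h2 : v ^ 2 < 1 := by nlinarith
    have := (one_lt_div (by positivity : 0 < v ^ 2)).2 h2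
    linarith
  · rintro rfl
    norm_num
  · intro hμ
    rw [hG]
    have hc : 0 < (1 / v ^ 4) * (1 - μ) := mul_pos (by positivity) (by linarith)
    refine ⟨?_, ?_, ?_⟩
    · rw [mul_pos_iff_of_pos_left hc]
      constructor <;> intro h <;> linarith
    · rw [mul_eq_zero_iff_left hc.ne']
      constructor <;> intro h <;> linarith
    · constructor
      · intro h
        have := neg_of_mul_neg_right h hc.le
        linarith
      · intro h
        exact mul_neg_of_pos_of_neg hc (by linarith)
end
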